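/- arXiv:1811.00881 — 3 statements merged into one kernel-verified Lean document; each statement's English description precedes it below -/
import Mathlib

section
/- Let n ≥ 1, 1 ≤ p < +∞ and −n < a < +∞, and let C_n > 0 be a fixed positive constant. If u ∈ C(cl(ℝⁿ₊)) is a nonnegative solution of the integral equation u(x) = ∫_{ℝⁿ₊} C_n (ln(1/|x−y|) − ln(1/|x̄−y|)) |y|^a u(y)^p dy for all x ∈ ℝⁿ₊, then u ≡ 0. -/
open MeasureTheory Real Set Metric

noncomputable section

abbrev E (n : ℕ) := EuclideanSpace ℝ (Fin n)

/-- The last coordinate `xₙ` of a point `x ∈ ℝⁿ` (junk value `0` when `n = 0`). -/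
def lastCoord (n : ℕ) (x : E n) : ℝ :=
  if h : 0 < n then x ⟨n - 1, Nat.sub_lt h Nat.one_pos⟩ else 0

/-- The upper half space `ℝⁿ₊ = {x : xₙ > 0}`. -/
def halfSpace (n : ℕ) : Set (E n) := {x | 0 < lastCoord n x}

/-- The last standard basis vector `eₙ`. -/
def lastBasis (n : ℕ) : E n :=
  if h : 0 < n then EuclideanSpace.single ⟨n - 1, Nat.sub_lt h Nat.one_pos⟩ (1 : ℝ) else 0

/-- The reflection `x̄ = (x₁, …, x_{n−1}, −xₙ)` of `x` across `∂ℝⁿ₊`. -/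
def reflect (n : ℕ) (x : E n) : E n := x - (2 * lastCoord n x) • lastBasis n

/-- The kernel `G⁺(x,y) = C_n (ln(1/|x−y|) − ln(1/|x̄−y|))`, the Green function of
`(−Δ)^{n/2}` on the half space with Navier boundary conditions. -/
def Gplus (n : ℕ) (Cn : ℝ) (x y : E n) : ℝ :=
  Cn * (Real.log (1 / ‖x - y‖) - Real.log (1 / ‖reflect n x - y‖))

/-- The Laplacian `Δu = ∑ᵢ ∂²u/∂xᵢ²`. -/
def lap (n : ℕ) (u : E n → ℝ) (x : E n) : ℝ :=
  ∑ i, fderiv ℝ (fun y => fderiv ℝ u y (EuclideanSpace.single i 1)) x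
    (EuclideanSpace.single i 1)

/-- The iterate `(−Δ)^k u` of the negative Laplacian. -/
def negLapIter (n k : ℕ) (u : E n → ℝ) : E n → ℝ :=
  (fun v x => - lap n v x)^[k] u

open Filter Topology EuclideanGeometry

section HalfSpace

variable {n : ℕ}

theorem lastCoord_sub (x y : E n) : lastCoord n (x - y) = lastCoord n x - lastCoord n y := by
  unfold lastCoord; split <;> simp

theorem lastCoord_smul (c : ℝ) (x : E n) : lastCoord n (c • x) = c * lastCoord n x := by
  unfold lastCoord; split <;> simp

theorem abs_lastCoord_le (x : E n) : |lastCoord n x| ≤ ‖x‖ := by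
  unfold lastCoord
  split
  · simpa using PiLp.norm_apply_le x _
  · simp

theorem lastCoord_le_norm (x : E n) : lastCoord n x ≤ ‖x‖ :=
  (le_abs_self _).trans (abs_lastCoord_le x)

@[fun_prop]
theorem continuous_lastCoord : Continuous (lastCoord n) := by
  unfold lastCoord
  split
  · fun_prop
  · exact continuous_const

theorem isOpen_halfSpace : IsOpen (halfSpace n) :=
  isOpen_lt continuous_const continuous_lastCoord

theorem ne_zero_of_mem_halfSpace {x : E n} (hx : x ∈ halfSpace n) : x ≠ 0 := by
  rintro rfl
  simp [halfSpace, lastCoord] at hx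

theorem norm_pos_of_mem_halfSpace {x : E n} (hx : x ∈ halfSpace n) : 0 < ‖x‖ :=
  norm_pos_iff.2 (ne_zero_of_mem_halfSpace hx)

theorem lastCoord_lastBasis (hn : 1 ≤ n) : lastCoord n (lastBasis n) = 1 := by
  simp [lastCoord, lastBasis, show 0 < n from hn]

theorem norm_lastBasis (hn : 1 ≤ n) : ‖lastBasis n‖ = 1 := by
  simp [lastBasis, show 0 < n from hn]

theorem inner_lastBasis (x : E n) : inner ℝ x (lastBasis n) = lastCoord n x := by
  unfold lastCoord lastBasis
  split
  · simp [EuclideanSpace.inner_single_right]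
  · simp

theorem norm_reflect_sub_sq (hn : 1 ≤ n) (x y : E n) :
    ‖reflect n x - y‖ ^ 2 = ‖x - y‖ ^ 2 + 4 * lastCoord n x * lastCoord n y := by
  have h : reflect n x - y = (x - y) - (2 * lastCoord n x) • lastBasis n := by
    unfold reflect; abel
  rw [h, norm_sub_sq_real, inner_smul_right, inner_lastBasis, norm_smul, norm_lastBasis hn,
    lastCoord_sub, mul_one, Real.norm_eq_abs, sq_abs]
  ring

end HalfSpace

section Kernel

variable {n : ℕ} {C : ℝ}

/-- A form of `Gplus` which is nonnegative also on the diagonal of the half space. -/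
def green (n : ℕ) (C : ℝ) (x y : E n) : ℝ :=
  C / 2 * Real.log (1 + 4 * lastCoord n x * lastCoord n y / ‖x - y‖ ^ 2)

theorem Gplus_eq_green (hn : 1 ≤ n) {x y : E n} (hx : x ∈ halfSpace n) (hy : y ∈ halfSpace n)
    (hxy : x ≠ y) : Gplus n C x y = green n C x y := by
  have hx' : 0 < lastCoord n x := hx
  have hy' : 0 < lastCoord n y := hy
  have h0 : 0 < ‖x - y‖ ^ 2 := by have := norm_pos_iff.2 (sub_ne_zero.2 hxy); positivity
  have hr := norm_reflect_sub_sq hn x y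
  have h1 : 0 < ‖reflect n x - y‖ ^ 2 := by rw [hr]; positivity
  have h2 : 1 + 4 * lastCoord n x * lastCoord n y / ‖x - y‖ ^ 2
      = ‖reflect n x - y‖ ^ 2 / ‖x - y‖ ^ 2 := by
    rw [hr, add_div, div_self h0.ne']
  rw [Gplus, green, h2, Real.log_div h1.ne' h0.ne', Real.log_pow, Real.log_pow]
  simp only [one_div, Real.log_inv]
  push_cast
  ring

theorem green_nonneg (hC : 0 < C) {x y : E n} (hx : x ∈ halfSpace n) (hy : y ∈ halfSpace n) :
    0 ≤ green n C x y := by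
  have hx' : 0 < lastCoord n x := hx
  have hy' : 0 < lastCoord n y := hy
  refine mul_nonneg (by positivity) (Real.log_nonneg ?_)
  have : 0 ≤ 4 * lastCoord n x * lastCoord n y / ‖x - y‖ ^ 2 := by positivity
  linarith

theorem green_pos (hC : 0 < C) {x y : E n} (hx : x ∈ halfSpace n) (hy : y ∈ halfSpace n)
    (hxy : x ≠ y) : 0 < green n C x y := by
  have hx' : 0 < lastCoord n x := hx
  have hy' : 0 < lastCoord n y := hy
  have h0 : 0 < ‖x - y‖ := norm_pos_iff.2 (sub_ne_zero.2 hxy)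
  refine mul_pos (by positivity) (Real.log_pos ?_)
  have : 0 < 4 * lastCoord n x * lastCoord n y / ‖x - y‖ ^ 2 := by positivity
  linarith

theorem measurable_green (x : E n) : Measurable (green n C x) := by
  have h : Measurable (lastCoord n) := continuous_lastCoord.measurable
  unfold green
  fun_prop

theorem inversion_zero_eq (R : ℝ) (x : E n) : inversion 0 R x = (R / ‖x‖) ^ 2 • x := by
  simp [inversion]

theorem norm_inversion_zero (R : ℝ) (x : E n) : ‖inversion 0 R x‖ = R ^ 2 / ‖x‖ := by
  simpa using dist_inversion_center (0 : E n) x R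

theorem lastCoord_inversion (R : ℝ) (x : E n) :
    lastCoord n (inversion 0 R x) = (R / ‖x‖) ^ 2 * lastCoord n x := by
  rw [inversion_zero_eq, lastCoord_smul]

theorem inversion_mem_halfSpace {R : ℝ} (hR : 0 < R) {x : E n} (hx : x ∈ halfSpace n) :
    inversion 0 R x ∈ halfSpace n := by
  have := norm_pos_of_mem_halfSpace hx
  have hx' : 0 < lastCoord n x := hx
  change 0 < lastCoord n (inversion 0 R x)
  rw [lastCoord_inversion]
  positivity

/-- Conformal invariance of the Green function. -/
theorem green_inversion_inversion {R : ℝ} (hR : 0 < R) {x y : E n} (hx : x ∈ halfSpace n)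
    (hy : y ∈ halfSpace n) :
    green n C (inversion 0 R x) (inversion 0 R y) = green n C x y := by
  have hx0 := norm_pos_of_mem_halfSpace hx
  have hy0 := norm_pos_of_mem_halfSpace hy
  have h := dist_inversion_inversion (ne_zero_of_mem_halfSpace hx) (ne_zero_of_mem_halfSpace hy) R
  simp only [dist_eq_norm, sub_zero] at h
  unfold green
  rw [h, lastCoord_inversion, lastCoord_inversion]
  congr 3
  rcases eq_or_ne x y with rfl | hxy
  · simp
  have h0 : 0 < ‖x - y‖ := norm_pos_iff.2 (sub_ne_zero.2 hxy)
  field_simp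

theorem green_inversion_left {R : ℝ} (hR : 0 < R) {x y : E n} (hx : x ∈ halfSpace n)
    (hy : y ∈ halfSpace n) :
    green n C (inversion 0 R x) y = green n C x (inversion 0 R y) := by
  rw [← green_inversion_inversion hR hx (inversion_mem_halfSpace hR hy),
    inversion_inversion 0 hR.ne']

/-- Inside the ball of radius `R`, the Green function dominates its reflection. -/
theorem green_inversion_right_lt (hC : 0 < C) {R : ℝ} (hR : 0 < R) {x y : E n}
    (hx : x ∈ halfSpace n) (hy : y ∈ halfSpace n) (hxy : x ≠ y) (hxR : ‖x‖ < R) (hyR : ‖y‖ < R) :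
    green n C x (inversion 0 R y) < green n C x y := by
  have hx' : 0 < lastCoord n x := hx
  have hy' : 0 < lastCoord n y := hy
  have hx0 := norm_pos_of_mem_halfSpace hx
  have hy0 := norm_pos_of_mem_halfSpace hy
  have h0 : 0 < ‖x - y‖ := norm_pos_iff.2 (sub_ne_zero.2 hxy)
  have key : R ^ 2 * ‖x - y‖ ^ 2 < ‖y‖ ^ 2 * ‖x - inversion 0 R y‖ ^ 2 := by
    have e1 : ‖x - y‖ ^ 2 = ‖x‖ ^ 2 - 2 * inner ℝ x y + ‖y‖ ^ 2 := norm_sub_sq_real x y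
    have e2 : ‖x - inversion 0 R y‖ ^ 2
        = ‖x‖ ^ 2 - 2 * ((R / ‖y‖) ^ 2 * inner ℝ x y) + (R ^ 2 / ‖y‖) ^ 2 := by
      rw [norm_sub_sq_real, norm_inversion_zero, inversion_zero_eq, inner_smul_right]
    have e3 : ‖y‖ ^ 2 * ‖x - inversion 0 R y‖ ^ 2 - R ^ 2 * ‖x - y‖ ^ 2
        = (R ^ 2 - ‖x‖ ^ 2) * (R ^ 2 - ‖y‖ ^ 2) := by
      rw [e1, e2]; field_simp; ring
    have e4 : 0 < (R ^ 2 - ‖x‖ ^ 2) * (R ^ 2 - ‖y‖ ^ 2) :=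
      mul_pos (by nlinarith) (by nlinarith)
    linarith
  have h1 : 0 < ‖x - inversion 0 R y‖ ^ 2 := by
    by_contra hcon
    have : 0 ≤ R ^ 2 * ‖x - y‖ ^ 2 := by positivity
    nlinarith [sq_nonneg ‖y‖]
  unfold green
  refine mul_lt_mul_of_pos_left (Real.log_lt_log ?_ ?_) (by positivity)
  · rw [lastCoord_inversion]; positivity
  · rw [lastCoord_inversion]
    gcongr 1 + ?_
    rw [div_lt_div_iff₀ h1 (by positivity)]
    have : 0 < 4 * lastCoord n x * lastCoord n y / ‖y‖ ^ 2 := by positivity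
    calc 4 * lastCoord n x * ((R / ‖y‖) ^ 2 * lastCoord n y) * ‖x - y‖ ^ 2
        = 4 * lastCoord n x * lastCoord n y / ‖y‖ ^ 2 * (R ^ 2 * ‖x - y‖ ^ 2) := by
          field_simp
      _ < 4 * lastCoord n x * lastCoord n y / ‖y‖ ^ 2 *
          (‖y‖ ^ 2 * ‖x - inversion 0 R y‖ ^ 2) := mul_lt_mul_of_pos_left key this
      _ = _ := by field_simp

/-- Comparison of the Green functions with different poles, away from both. -/
theorem green_le_mul_green (hC : 0 < C) {x z y : E n} (hx : x ∈ halfSpace n)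
    (hz : z ∈ halfSpace n) (hy : y ∈ halfSpace n) (hxy : 2 * ‖x‖ ≤ ‖y‖) (hzy : ‖z‖ ≤ ‖y‖)
    (hne : z ≠ y) :
    green n C x y ≤ (1 + 16 * lastCoord n x / lastCoord n z) * green n C z y := by
  have hx' : 0 < lastCoord n x := hx
  have hy' : 0 < lastCoord n y := hy
  have hz' : 0 < lastCoord n z := hz
  have hy0 := norm_pos_of_mem_halfSpace hy
  have h0 : 0 < ‖z - y‖ := norm_pos_iff.2 (sub_ne_zero.2 hne)
  set M := 1 + 16 * lastCoord n x / lastCoord n z with hM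
  have hM1 : 1 ≤ M := by
    have : 0 ≤ 16 * lastCoord n x / lastCoord n z := by positivity
    linarith
  set t := 4 * lastCoord n z * lastCoord n y / ‖z - y‖ ^ 2 with ht
  have ht0 : 0 ≤ t := by positivity
  have h1 : ‖y‖ / 2 ≤ ‖x - y‖ := by
    have := norm_sub_norm_le y x
    rw [norm_sub_rev] at this
    linarith
  have h2 : ‖z - y‖ ≤ 2 * ‖y‖ := (norm_sub_le z y).trans (by linarith)
  have h3 : 4 * lastCoord n x * lastCoord n y / ‖x - y‖ ^ 2 ≤ M * t := by
    calc 4 * lastCoord n x * lastCoord n y / ‖x - y‖ ^ 2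
        ≤ 4 * lastCoord n x * lastCoord n y / (‖y‖ / 2) ^ 2 := by gcongr
      _ = 16 * lastCoord n x / lastCoord n z *
          (4 * lastCoord n z * lastCoord n y / (2 * ‖y‖) ^ 2) := by field_simp; ring
      _ ≤ 16 * lastCoord n x / lastCoord n z * t := by rw [ht]; gcongr
      _ ≤ M * t := by gcongr; rw [hM]; linarith
  have h4 : Real.log (1 + M * t) ≤ M * Real.log (1 + t) := by
    rw [← Real.log_rpow (by linarith)]
    exact Real.log_le_log (by positivity)
      (one_add_mul_self_le_rpow_one_add (by linarith) hM1)
  unfold green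
  have h5 : Real.log (1 + 4 * lastCoord n x * lastCoord n y / ‖x - y‖ ^ 2)
      ≤ Real.log (1 + M * t) := Real.log_le_log (by positivity) (by linarith)
  calc _ ≤ C / 2 * (M * Real.log (1 + t)) :=
        mul_le_mul_of_nonneg_left (h5.trans h4) (by positivity)
    _ = _ := by ring

end Kernel

section Potential

variable {n : ℕ} {a C : ℝ}

theorem green_le_rpow (hC : 0 < C) {R d : ℝ} (hd : 0 < d) {x y : E n} (hx : x ∈ halfSpace n)
    (hy : y ∈ halfSpace n) (hxy : x ≠ y) (hxR : ‖x‖ < R) (hyR : ‖y‖ < R) :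
    green n C x y ≤ C / 2 * ((8 * R ^ 2) ^ (d / 2) / (d / 2)) * ‖x - y‖ ^ (-d) := by
  have hx' : 0 < lastCoord n x := hx
  have hy' : 0 < lastCoord n y := hy
  have h0 : 0 < ‖x - y‖ := norm_pos_iff.2 (sub_ne_zero.2 hxy)
  have hR : 0 < R := (norm_nonneg x).trans_lt hxR
  have h2 : ‖x - y‖ ≤ 2 * R := (norm_sub_le x y).trans (by linarith)
  have h3 : lastCoord n x ≤ R := (lastCoord_le_norm x).trans hxR.le
  have h4 : lastCoord n y ≤ R := (lastCoord_le_norm y).trans hyR.le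
  have h5 : 1 + 4 * lastCoord n x * lastCoord n y / ‖x - y‖ ^ 2 ≤ 8 * R ^ 2 / ‖x - y‖ ^ 2 := by
    rw [le_div_iff₀ (by positivity), add_mul, div_mul_cancel₀ _ (by positivity)]
    nlinarith [mul_le_mul h3 h4 hy'.le hR.le]
  have h6 : (8 * R ^ 2 / ‖x - y‖ ^ 2) ^ (d / 2) = (8 * R ^ 2) ^ (d / 2) * ‖x - y‖ ^ (-d) := by
    rw [Real.div_rpow (by positivity) (by positivity), Real.rpow_neg h0.le, div_eq_mul_inv]
    congr 2
    rw [← Real.rpow_natCast, ← Real.rpow_mul h0.le]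
    congr 1
    push_cast
    ring
  unfold green
  calc _ ≤ C / 2 * Real.log (8 * R ^ 2 / ‖x - y‖ ^ 2) :=
        mul_le_mul_of_nonneg_left (Real.log_le_log (by positivity) h5) (by positivity)
    _ ≤ C / 2 * ((8 * R ^ 2 / ‖x - y‖ ^ 2) ^ (d / 2) / (d / 2)) :=
        mul_le_mul_of_nonneg_left (Real.log_le_rpow_div (by positivity) (by positivity))
          (by positivity)
    _ = _ := by rw [h6]; ring

theorem rpow_neg_mul_rpow_neg_le {r s b d : ℝ} (hr : 0 < r) (hs : 0 < s) (hb : 0 ≤ b)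
    (hd : 0 ≤ d) : r ^ (-d) * s ^ (-b) ≤ r ^ (-(b + d)) + s ^ (-(b + d)) := by
  rcases le_total r s with h | h
  · calc r ^ (-d) * s ^ (-b) ≤ r ^ (-d) * r ^ (-b) := by
          gcongr ?_ * ?_
          exact Real.rpow_le_rpow_of_nonpos hr h (by linarith)
      _ = r ^ (-(b + d)) := by rw [← Real.rpow_add hr]; ring_nf
      _ ≤ _ := by have := Real.rpow_pos_of_pos hs (-(b + d)); linarith
  · calc r ^ (-d) * s ^ (-b) ≤ s ^ (-d) * s ^ (-b) := by
          gcongr ?_ * ?_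
          exact Real.rpow_le_rpow_of_nonpos hs h (by linarith)
      _ = s ^ (-(b + d)) := by rw [← Real.rpow_add hs]; ring_nf
      _ ≤ _ := by have := Real.rpow_pos_of_pos hr (-(b + d)); linarith

theorem exists_green_mul_rpow_le (ha : -(n : ℝ) < a) (hn : 1 ≤ n) (hC : 0 < C) (R : ℝ) :
    ∃ b K : ℝ, b < n ∧ 0 ≤ K ∧ ∀ x ∈ halfSpace n ∩ ball 0 R, ∀ y ∈ halfSpace n ∩ ball 0 R, x ≠ y →
      green n C x y * ‖y‖ ^ a ≤ K * (‖x - y‖ ^ (-b) + ‖y‖ ^ (-b)) := by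
  rcases le_or_gt R 0 with hR | hR
  · refine ⟨0, 0, by positivity, le_rfl, fun x hx => ?_⟩
    simp [ball_eq_empty.2 hR] at hx
  have hn' : (1 : ℝ) ≤ n := by exact_mod_cast hn
  set b₀ : ℝ := max (-a) 0 with hb₀
  have hb₀n : b₀ < n := max_lt (by linarith) (by linarith)
  have hb₀0 : 0 ≤ b₀ := le_max_right _ _
  set d : ℝ := (n - b₀) / 2 with hd
  have hd0 : 0 < d := by rw [hd]; linarith
  refine ⟨b₀ + d, C / 2 * ((8 * R ^ 2) ^ (d / 2) / (d / 2)) * R ^ (a + b₀), by rw [hd]; linarith,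
    by positivity, ?_⟩
  rintro x ⟨hx, hxR⟩ y ⟨hy, hyR⟩ hxy
  rw [mem_ball_zero_iff] at hxR hyR
  have hy0 := norm_pos_of_mem_halfSpace hy
  have h0 : 0 < ‖x - y‖ := norm_pos_iff.2 (sub_ne_zero.2 hxy)
  have h1 := green_le_rpow hC hd0 hx hy hxy hxR hyR
  have h2 : ‖y‖ ^ a ≤ R ^ (a + b₀) * ‖y‖ ^ (-b₀) := by
    calc ‖y‖ ^ a = ‖y‖ ^ (a + b₀) * ‖y‖ ^ (-b₀) := by rw [← Real.rpow_add hy0]; ring_nf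
      _ ≤ _ := by
        gcongr
        linarith [le_max_left (-a) 0]
  calc green n C x y * ‖y‖ ^ a
      ≤ (C / 2 * ((8 * R ^ 2) ^ (d / 2) / (d / 2)) * ‖x - y‖ ^ (-d)) *
        (R ^ (a + b₀) * ‖y‖ ^ (-b₀)) := by gcongr
    _ = C / 2 * ((8 * R ^ 2) ^ (d / 2) / (d / 2)) * R ^ (a + b₀) *
        (‖x - y‖ ^ (-d) * ‖y‖ ^ (-b₀)) := by ring
    _ ≤ _ := by
        gcongr
        exact rpow_neg_mul_rpow_neg_le h0 hy0 hb₀0 hd0.le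

theorem nontrivial_E (hn : 1 ≤ n) : Nontrivial (E n) :=
  Module.nontrivial_of_finrank_pos (R := ℝ) (by simpa using show 0 < n from hn)

theorem ae_ne (hn : 1 ≤ n) (x : E n) (s : Set (E n)) : ∀ᵐ y ∂(volume.restrict s), x ≠ y := by
  have := nontrivial_E hn
  exact ae_restrict_of_ae
    ((MeasureTheory.Measure.ae_ne volume x).mono fun _ h => h.symm)

/-- The weighted Green function is integrable near the origin, uniformly in the pole. -/
theorem exists_green_uniformly_integrable (ha : -(n : ℝ) < a) (hn : 1 ≤ n) (hC : 0 < C) (R : ℝ) :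
    (∀ x ∈ halfSpace n ∩ ball 0 R,
      IntegrableOn (fun y => green n C x y * ‖y‖ ^ a) (halfSpace n ∩ ball 0 R)) ∧
    ∀ η > 0, ∃ δ > 0, ∀ x ∈ halfSpace n ∩ ball 0 R, ∀ A ⊆ halfSpace n ∩ ball 0 R,
      MeasurableSet A → volume A < δ → ∫ y in A, green n C x y * ‖y‖ ^ a ≤ η := by
  obtain ⟨b, K, hb, hK, hle⟩ := exists_green_mul_rpow_le ha hn hC R
  set h : E n → ℝ := (ball 0 (2 * R)).indicator (fun z => ‖z‖ ^ (-b)) with hh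
  have h_int : Integrable h := by
    rw [hh, integrable_indicator_iff measurableSet_ball]
    refine integrableOn_ball_of_norm_le_rpow (C := 1) (α := b) (by rwa [finrank_euclideanSpace_fin])
      (by rwa [finrank_euclideanSpace_fin])
      (ae_of_all _ fun x => ?_) ?_
    · rw [one_mul, Real.norm_of_nonneg (by positivity)]
    · exact Measurable.aestronglyMeasurable (by fun_prop)
  have h_nonneg : ∀ z, 0 ≤ h z := fun z => indicator_nonneg (fun _ _ => by positivity) z
  have hle' : ∀ x ∈ halfSpace n ∩ ball 0 R, ∀ y ∈ halfSpace n ∩ ball 0 R, x ≠ y →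
      green n C x y * ‖y‖ ^ a ≤ K * (h (x - y) + h y) := by
    intro x hx y hy hxy
    have h1 : y ∈ ball (0 : E n) (2 * R) := by
      have := hy.2
      rw [mem_ball_zero_iff] at this ⊢
      linarith [norm_nonneg y]
    have h2 : x - y ∈ ball (0 : E n) (2 * R) := by
      have h3 := hy.2
      have h4 := hx.2
      rw [mem_ball_zero_iff] at h3 h4 ⊢
      linarith [norm_sub_le x y]
    rw [hh, indicator_of_mem h1, indicator_of_mem h2]
    exact hle x hx y hy hxy
  have hmeas : MeasurableSet (halfSpace n ∩ ball 0 R) :=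
    isOpen_halfSpace.measurableSet.inter measurableSet_ball
  have hint1 : ∀ x, Integrable (fun y => h (x - y)) := fun x => h_int.comp_sub_left x
  have hint2 : ∀ x, Integrable (fun y => K * (h (x - y) + h y)) := fun x =>
    ((hint1 x).add h_int).const_mul K
  have hint : ∀ x ∈ halfSpace n ∩ ball 0 R,
      IntegrableOn (fun y => green n C x y * ‖y‖ ^ a) (halfSpace n ∩ ball 0 R) := by
    intro x hx
    refine Integrable.mono' (hint2 x).integrableOn ?_ ?_
    · have := measurable_green (C := C) x
      exact Measurable.aestronglyMeasurable (by fun_prop)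
    · filter_upwards [ae_ne hn x _, ae_restrict_mem hmeas] with y hxy hy
      have := green_nonneg hC hx.1 hy.1
      rw [Real.norm_of_nonneg (by positivity)]
      exact hle' x hx y hy hxy
  refine ⟨hint, fun η hη => ?_⟩
  have hε : 0 < η / (2 * (K + 1)) := by positivity
  obtain ⟨δ, hδ0, hδ⟩ : ∃ δ > 0, ∀ s : Set (E n), volume s < δ →
      ∫ z in s, h z ≤ η / (2 * (K + 1)) := by
    obtain ⟨δ, hδ0, hδ⟩ := exists_pos_setLIntegral_lt_of_measure_lt
      (μ := (volume : Measure (E n))) (f := fun z => ENNReal.ofReal (h z))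
      h_int.lintegral_lt_top.ne (ε := ENNReal.ofReal (η / (2 * (K + 1)))) (by simpa using hε)
    refine ⟨δ, hδ0, fun s hs => ?_⟩
    rw [integral_eq_lintegral_of_nonneg_ae (ae_of_all _ h_nonneg)
      h_int.aestronglyMeasurable.restrict]
    exact ENNReal.toReal_le_of_le_ofReal hε.le (hδ s hs).le
  refine ⟨δ, hδ0, fun x hx A hA hAm hAδ => ?_⟩
  have hmp : MeasurePreserving (fun y : E n => x - y) volume volume :=
    volume.measurePreserving_sub_left x
  have hemb : MeasurableEmbedding (fun y : E n => x - y) :=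
    (MeasurableEquiv.subLeft x).measurableEmbedding
  have hpre : (fun y : E n => x - y) ⁻¹' ((fun y : E n => x - y) ⁻¹' A) = A := by
    ext y; simp
  have hsub : ∫ y in A, h (x - y) = ∫ z in (fun y : E n => x - y) ⁻¹' A, h z := by
    have := hmp.setIntegral_preimage_emb hemb h ((fun y : E n => x - y) ⁻¹' A)
    rwa [hpre] at this
  have hvol : volume ((fun y : E n => x - y) ⁻¹' A) < δ := by
    rwa [hmp.measure_preimage hAm.nullMeasurableSet]
  calc ∫ y in A, green n C x y * ‖y‖ ^ a
      ≤ ∫ y in A, K * (h (x - y) + h y) := by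
        refine setIntegral_mono_ae_restrict ((hint x hx).mono_set hA) (hint2 x).integrableOn ?_
        filter_upwards [ae_ne hn x _, ae_restrict_mem hAm] with y hxy hy
        exact hle' x hx y (hA hy) hxy
    _ = K * ((∫ z in (fun y : E n => x - y) ⁻¹' A, h z) + ∫ y in A, h y) := by
        rw [integral_const_mul, integral_add (hint1 x).integrableOn h_int.integrableOn, hsub]
    _ ≤ K * (η / (2 * (K + 1)) + η / (2 * (K + 1))) := by
        gcongr
        · exact hδ _ hvol
        · exact hδ _ hAδ
    _ = η * (K / (K + 1)) := by field_simp; ring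
    _ ≤ η * 1 := by
        gcongr
        rw [div_le_one (by positivity)]
        linarith
    _ = η := mul_one η

end Potential

section Inversion

variable {n : ℕ}

theorem abs_det_fderiv_inversion (R : ℝ) (x : E n) :
    |((R / dist x 0) ^ 2 • ((ℝ ∙ (x - 0))ᗮ.reflection : E n →L[ℝ] E n)).det|
      = (R / ‖x‖) ^ (2 * n) := by
  have h : |(((ℝ ∙ (x - 0))ᗮ.reflection : E n →L[ℝ] E n) : E n →ₗ[ℝ] E n).det| = 1 := by
    have := Submodule.det_reflection (𝕜 := ℝ) (E := E n) (K := (ℝ ∙ (x - 0))ᗮ)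
    have h2 : (((ℝ ∙ (x - 0))ᗮ.reflection : E n →L[ℝ] E n) : E n →ₗ[ℝ] E n).det
      = LinearMap.det (ℝ ∙ (x - 0))ᗮ.reflection.toLinearMap := rfl
    rw [h2, this, abs_pow]
    simp
  rw [ContinuousLinearMap.det, ContinuousLinearMap.toLinearMap_smul, LinearMap.det_smul, abs_mul, h,
    pow_mul, mul_one, abs_pow, abs_of_nonneg (sq_nonneg _)]
  simp

theorem image_inversion_halfSpace_inter_ball {R : ℝ} (hR : 0 < R) :
    inversion 0 R '' (halfSpace n ∩ ball 0 R) = halfSpace n \ closedBall 0 R := by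
  ext y
  constructor
  · rintro ⟨x, ⟨hx, hxR⟩, rfl⟩
    refine ⟨inversion_mem_halfSpace hR hx, ?_⟩
    have := norm_pos_of_mem_halfSpace hx
    rw [mem_ball_zero_iff] at hxR
    rw [mem_closedBall_zero_iff, norm_inversion_zero, not_le, lt_div_iff₀ this]
    nlinarith
  · rintro ⟨hy, hyR⟩
    have := norm_pos_of_mem_halfSpace hy
    rw [mem_closedBall_zero_iff, not_le] at hyR
    refine ⟨inversion 0 R y, ⟨inversion_mem_halfSpace hR hy, ?_⟩, inversion_inversion 0 hR.ne' y⟩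
    rw [mem_ball_zero_iff, norm_inversion_zero, div_lt_iff₀ this]
    nlinarith

/-- Folding an integral over the half space into a half ball by inversion. -/
theorem setIntegral_halfSpace_eq_fold (hn : 1 ≤ n) {R : ℝ} (hR : 0 < R) {F : E n → ℝ}
    (hF : IntegrableOn F (halfSpace n)) :
    IntegrableOn (fun y => (R / ‖y‖) ^ (2 * n) * F (inversion 0 R y)) (halfSpace n ∩ ball 0 R) ∧
    ∫ y in halfSpace n, F y = ∫ y in halfSpace n ∩ ball 0 R,
      (F y + (R / ‖y‖) ^ (2 * n) * F (inversion 0 R y)) := by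
  have := nontrivial_E hn
  have hm : MeasurableSet (halfSpace n ∩ ball 0 R) :=
    isOpen_halfSpace.measurableSet.inter measurableSet_ball
  have hderiv : ∀ x ∈ halfSpace n ∩ ball 0 R, HasFDerivWithinAt (inversion 0 R)
      ((R / dist x 0) ^ 2 • ((ℝ ∙ (x - 0))ᗮ.reflection : E n →L[ℝ] E n))
      (halfSpace n ∩ ball 0 R) x := fun x hx =>
    (hasFDerivAt_inversion (ne_zero_of_mem_halfSpace hx.1)).hasFDerivWithinAt
  have hinj : InjOn (inversion (0 : E n) R) (halfSpace n ∩ ball 0 R) :=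
    (inversion_injective 0 hR.ne').injOn
  have hF' : IntegrableOn F (inversion 0 R '' (halfSpace n ∩ ball 0 R)) := by
    rw [image_inversion_halfSpace_inter_ball hR]
    exact hF.mono_set sdiff_subset
  have h1 := (integrableOn_image_iff_integrableOn_abs_det_fderiv_smul volume hm hderiv hinj F).1 hF'
  have h2 := integral_image_eq_integral_abs_det_fderiv_smul volume hm hderiv hinj F
  simp only [abs_det_fderiv_inversion, smul_eq_mul] at h1 h2
  refine ⟨h1, ?_⟩
  rw [integral_add (hF.mono_set inter_subset_left) h1, ← h2,
    image_inversion_halfSpace_inter_ball hR]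
  have hae : (halfSpace n \ closedBall 0 R : Set (E n)) =ᵐ[volume]
      (halfSpace n \ ball 0 R : Set (E n)) := by
    refine eventuallyEq_set.2 ?_
    have hs : ∀ᵐ y : E n, y ∉ sphere (0 : E n) R :=
      measure_eq_zero_iff_ae_notMem.1 (Measure.addHaar_sphere volume 0 R)
    filter_upwards [hs] with y hy
    rw [mem_sphere_zero_iff_norm] at hy
    simp [le_iff_lt_or_eq, hy]
  rw [setIntegral_congr_set hae, integral_inter_add_sdiff measurableSet_ball hF]

end Inversion

/-- A positive solution of the integral equation, with convergent integrals. -/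
structure IsPositiveSolution (n : ℕ) (a p C : ℝ) (u : E n → ℝ) : Prop where
  one_le_dim : 1 ≤ n
  neg_dim_lt : -(n : ℝ) < a
  one_le_exp : 1 ≤ p
  const_pos : 0 < C
  continuousOn : ContinuousOn u (closure (halfSpace n))
  pos : ∀ x ∈ halfSpace n, 0 < u x
  integrableOn : ∀ x ∈ halfSpace n,
    IntegrableOn (fun y => green n C x y * (‖y‖ ^ a * u y ^ p)) (halfSpace n)
  eq_integral : ∀ x ∈ halfSpace n,
    u x = ∫ y in halfSpace n, green n C x y * (‖y‖ ^ a * u y ^ p)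

theorem exists_forall_le_of_continuousOn_closure {n : ℕ} {u : E n → ℝ}
    (hu : ContinuousOn u (closure (halfSpace n))) (R : ℝ) :
    ∃ M > 0, ∀ x ∈ halfSpace n ∩ ball 0 R, u x ≤ M := by
  have hc : IsCompact (closure (halfSpace n) ∩ closedBall 0 R) :=
    (isCompact_closedBall 0 R).inter_left isClosed_closure
  obtain ⟨M, hM⟩ := hc.bddAbove_image (hu.mono inter_subset_left)
  refine ⟨max M 1, by positivity, fun x hx => le_max_of_le_left ?_⟩
  exact hM ⟨x, ⟨subset_closure hx.1, ball_subset_closedBall hx.2⟩, rfl⟩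

theorem rpow_sub_rpow_le {p s t M : ℝ} (hp : 1 ≤ p) (hs : 0 ≤ s) (hst : s ≤ t) (htM : t ≤ M) :
    t ^ p - s ^ p ≤ p * M ^ (p - 1) * (t - s) := by
  rcases (hs.trans hst).eq_or_lt with ht | ht
  · obtain rfl : s = t := by linarith
    simp
  have h := one_add_mul_self_le_rpow_one_add (s := s / t - 1)
    (by have := div_nonneg hs ht.le; linarith) hp
  rw [add_sub_cancel, Real.div_rpow hs ht.le, le_div_iff₀ (by positivity)] at h
  have h1 : t ^ p = t ^ (p - 1) * t := by
    rw [← Real.rpow_add_one ht.ne']; ring_nf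
  have h2 : (1 + p * (s / t - 1)) * t ^ p = t ^ p - p * t ^ (p - 1) * (t - s) := by
    rw [h1]; field_simp; ring
  have h3 : p * t ^ (p - 1) * (t - s) ≤ p * M ^ (p - 1) * (t - s) := by
    have : t ^ (p - 1) ≤ M ^ (p - 1) := Real.rpow_le_rpow ht.le htM (by linarith)
    have h4 : 0 ≤ t - s := by linarith
    gcongr
  linarith

/-- The Jacobian of the inversion times the transformed weight exceeds the weight. -/
theorem rpow_norm_lt_inversion {n : ℕ} {a R : ℝ} (ha : -(n : ℝ) < a) {y : E n}
    (hy : 0 < ‖y‖) (hyR : ‖y‖ < R) :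
    ‖y‖ ^ a < (R / ‖y‖) ^ (2 * n) * ‖inversion 0 R y‖ ^ a := by
  have hR : 0 < R := hy.trans hyR
  have h1 : 1 < R / ‖y‖ := (one_lt_div hy).2 hyR
  have h2 : ‖inversion 0 R y‖ = (R / ‖y‖) ^ (2 : ℝ) * ‖y‖ := by
    rw [norm_inversion_zero, Real.rpow_two]; field_simp
  have h3 : (R / ‖y‖) ^ (2 * n) * ‖inversion 0 R y‖ ^ a
      = (R / ‖y‖) ^ (2 * (n + a)) * ‖y‖ ^ a := by
    rw [h2, Real.mul_rpow (by positivity) hy.le, ← Real.rpow_mul (by positivity),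
      ← Real.rpow_natCast, ← mul_assoc, ← Real.rpow_add (by positivity)]
    congr 2
    push_cast
    ring
  rw [h3]
  have h4 : 1 < (R / ‖y‖) ^ (2 * (n + a)) := Real.one_lt_rpow h1 (by linarith)
  have h5 : 0 < ‖y‖ ^ a := Real.rpow_pos_of_pos hy a
  nlinarith

/-- The points of the half ball of radius `R` where `u` exceeds its reflection in the sphere. -/
def badSet {n : ℕ} (u : E n → ℝ) (R : ℝ) : Set (E n) :=
  {y ∈ halfSpace n ∩ ball 0 R | u (inversion 0 R y) < u y}

namespace IsPositiveSolution

variable {n : ℕ} {a p C : ℝ} {u : E n → ℝ}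

theorem continuousAt (h : IsPositiveSolution n a p C u) {x : E n} (hx : x ∈ halfSpace n) :
    ContinuousAt u x :=
  (h.continuousOn.mono subset_closure).continuousAt (isOpen_halfSpace.mem_nhds hx)

theorem isOpen_badSet (h : IsPositiveSolution n a p C u) (R : ℝ) :
    IsOpen (badSet u R) := by
  rcases le_or_gt R 0 with hR | hR
  · simp [badSet, ball_eq_empty.2 hR]
  have ho : IsOpen (halfSpace n ∩ ball 0 R) := isOpen_halfSpace.inter isOpen_ball
  refine isOpen_iff_mem_nhds.2 fun y hy => ?_
  have hy0 := ne_zero_of_mem_halfSpace hy.1.1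
  have h1 : ContinuousAt (fun y => u (inversion 0 R y)) y :=
    ContinuousAt.comp (h.continuousAt (inversion_mem_halfSpace hR hy.1.1))
      (hasFDerivAt_inversion hy0).continuousAt
  filter_upwards [ho.mem_nhds hy.1, h1.eventually_lt (h.continuousAt hy.1.1) hy.2] with z h2 h3
  exact ⟨h2, h3⟩

theorem sub_inversion_eq (h : IsPositiveSolution n a p C u) {R : ℝ} (hR : 0 < R) {x : E n}
    (hx : x ∈ halfSpace n) :
    IntegrableOn (fun y => (green n C x y - green n C x (inversion 0 R y)) *
      (‖y‖ ^ a * u y ^ p -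
        (R / ‖y‖) ^ (2 * n) * ‖inversion 0 R y‖ ^ a * u (inversion 0 R y) ^ p))
      (halfSpace n ∩ ball 0 R) ∧
    u x - u (inversion 0 R x) = ∫ y in halfSpace n ∩ ball 0 R,
      (green n C x y - green n C x (inversion 0 R y)) *
      (‖y‖ ^ a * u y ^ p -
        (R / ‖y‖) ^ (2 * n) * ‖inversion 0 R y‖ ^ a * u (inversion 0 R y) ^ p) := by
  have hx' := inversion_mem_halfSpace hR hx
  have hm : MeasurableSet (halfSpace n ∩ ball 0 R) :=
    isOpen_halfSpace.measurableSet.inter measurableSet_ball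
  obtain ⟨i1, e1⟩ := setIntegral_halfSpace_eq_fold h.one_le_dim hR (h.integrableOn x hx)
  obtain ⟨i2, e2⟩ := setIntegral_halfSpace_eq_fold h.one_le_dim hR (h.integrableOn _ hx')
  have j1 := ((h.integrableOn x hx).mono_set inter_subset_left).add i1
  have j2 := ((h.integrableOn _ hx').mono_set inter_subset_left).add i2
  have heq : EqOn (fun y => (green n C x y * (‖y‖ ^ a * u y ^ p) +
        (R / ‖y‖) ^ (2 * n) * (green n C x (inversion 0 R y) *
          (‖inversion 0 R y‖ ^ a * u (inversion 0 R y) ^ p))) -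
      (green n C (inversion 0 R x) y * (‖y‖ ^ a * u y ^ p) +
        (R / ‖y‖) ^ (2 * n) * (green n C (inversion 0 R x) (inversion 0 R y) *
          (‖inversion 0 R y‖ ^ a * u (inversion 0 R y) ^ p))))
      (fun y => (green n C x y - green n C x (inversion 0 R y)) *
      (‖y‖ ^ a * u y ^ p -
        (R / ‖y‖) ^ (2 * n) * ‖inversion 0 R y‖ ^ a * u (inversion 0 R y) ^ p))
      (halfSpace n ∩ ball 0 R) := by
    intro y hy
    simp only [green_inversion_inversion hR hx hy.1, green_inversion_left hR hx hy.1]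
    ring
  refine ⟨(j1.sub j2).congr_fun heq hm, ?_⟩
  rw [h.eq_integral x hx, h.eq_integral _ hx', e1, e2, ← setIntegral_congr_fun hm heq]
  exact (integral_sub j1 j2).symm

theorem weight_sub_lt (h : IsPositiveSolution n a p C u) {R : ℝ} {y : E n}
    (hy : y ∈ halfSpace n ∩ ball 0 R) :
    ‖y‖ ^ a * u y ^ p - (R / ‖y‖) ^ (2 * n) * ‖inversion 0 R y‖ ^ a * u (inversion 0 R y) ^ p
      < ‖y‖ ^ a * (u y ^ p - u (inversion 0 R y) ^ p) := by
  have hy0 := norm_pos_of_mem_halfSpace hy.1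
  have hyR := mem_ball_zero_iff.1 hy.2
  have h1 := rpow_norm_lt_inversion h.neg_dim_lt hy0 hyR
  have h2 : 0 < u (inversion 0 R y) ^ p :=
    Real.rpow_pos_of_pos (h.pos _ (inversion_mem_halfSpace (hy0.trans hyR) hy.1)) p
  nlinarith

theorem sub_inversion_le_half (h : IsPositiveSolution n a p C u) {R M D : ℝ} (hR : 0 < R)
    (hM : 0 < M) (huM : ∀ x ∈ halfSpace n ∩ ball 0 R, u x ≤ M)
    (hint : ∀ x ∈ halfSpace n ∩ ball 0 R,
      IntegrableOn (fun y => green n C x y * ‖y‖ ^ a) (halfSpace n ∩ ball 0 R))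
    (hsmall : ∀ x ∈ halfSpace n ∩ ball 0 R,
      ∫ y in badSet u R, green n C x y * ‖y‖ ^ a ≤ 1 / (2 * (p * M ^ (p - 1))))
    (hD : 0 ≤ D) (hle : ∀ x ∈ halfSpace n ∩ ball 0 R, u x - u (inversion 0 R x) ≤ D) :
    ∀ x ∈ halfSpace n ∩ ball 0 R, u x - u (inversion 0 R x) ≤ D / 2 := by
  intro x hx
  have hp : 0 < p := by linarith [h.one_le_exp]
  have hm : MeasurableSet (halfSpace n ∩ ball 0 R) :=
    isOpen_halfSpace.measurableSet.inter measurableSet_ball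
  have hbm := (h.isOpen_badSet R).measurableSet
  have hbs : badSet u R ⊆ halfSpace n ∩ ball 0 R := sep_subset _ _
  obtain ⟨i, e⟩ := h.sub_inversion_eq hR hx.1
  have hL : 0 < p * M ^ (p - 1) := by positivity
  have i2 : IntegrableOn ((badSet u R).indicator
      (fun y => p * M ^ (p - 1) * D * (green n C x y * ‖y‖ ^ a))) (halfSpace n ∩ ball 0 R) :=
    ((hint x hx).const_mul _).indicator hbm
  calc u x - u (inversion 0 R x)
      ≤ ∫ y in halfSpace n ∩ ball 0 R, (badSet u R).indicator
          (fun y => p * M ^ (p - 1) * D * (green n C x y * ‖y‖ ^ a)) y := by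
        rw [e]
        refine setIntegral_mono_ae_restrict i i2 ?_
        filter_upwards [ae_ne h.one_le_dim x _, ae_restrict_mem hm] with y hxy hy
        have hy' := inversion_mem_halfSpace hR hy.1
        have hk := green_inversion_right_lt h.const_pos hR hx.1 hy.1 hxy
          (mem_ball_zero_iff.1 hx.2) (mem_ball_zero_iff.1 hy.2)
        have hk' := green_nonneg h.const_pos hx.1 hy'
        have hw := h.weight_sub_lt hy
        have hya : 0 < ‖y‖ ^ a := Real.rpow_pos_of_pos (norm_pos_of_mem_halfSpace hy.1) a
        by_cases hb : y ∈ badSet u R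
        · rw [indicator_of_mem hb]
          have h1 : u y ^ p - u (inversion 0 R y) ^ p ≤ p * M ^ (p - 1) * D :=
            (rpow_sub_rpow_le h.one_le_exp (h.pos _ hy').le hb.2.le (huM y hy)).trans
              (by gcongr; exact hle y hy)
          calc _ ≤ (green n C x y - green n C x (inversion 0 R y)) *
                (‖y‖ ^ a * (p * M ^ (p - 1) * D)) := by
                refine mul_le_mul_of_nonneg_left (hw.le.trans ?_) (by linarith)
                gcongr
            _ ≤ green n C x y * (‖y‖ ^ a * (p * M ^ (p - 1) * D)) := by
                refine mul_le_mul_of_nonneg_right (by linarith) (by positivity)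
            _ = _ := by ring
        · rw [indicator_of_notMem hb]
          have h1 : u y ≤ u (inversion 0 R y) := by
            by_contra hcon
            exact hb ⟨hy, not_le.1 hcon⟩
          have h2 : u y ^ p ≤ u (inversion 0 R y) ^ p :=
            Real.rpow_le_rpow (h.pos y hy.1).le h1 hp.le
          refine mul_nonpos_of_nonneg_of_nonpos (by linarith) (hw.le.trans ?_)
          exact mul_nonpos_of_nonneg_of_nonpos hya.le (by linarith)
    _ = p * M ^ (p - 1) * D * ∫ y in badSet u R, green n C x y * ‖y‖ ^ a := by
        rw [setIntegral_indicator hbm, inter_eq_self_of_subset_right hbs, integral_const_mul]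
    _ ≤ p * M ^ (p - 1) * D * (1 / (2 * (p * M ^ (p - 1)))) := by
        gcongr
        exact hsmall x hx
    _ = D / 2 := by field_simp

theorem exists_badSet_eq_empty (h : IsPositiveSolution n a p C u) (R₀ : ℝ) :
    ∃ δ > 0, ∀ R, 0 < R → R ≤ R₀ → volume (badSet u R) < δ → badSet u R = ∅ := by
  obtain ⟨M, hM, huM⟩ := exists_forall_le_of_continuousOn_closure h.continuousOn R₀
  have hp : 0 < p := by linarith [h.one_le_exp]
  obtain ⟨hint, hδ⟩ := exists_green_uniformly_integrable h.neg_dim_lt h.one_le_dim h.const_pos R₀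
  obtain ⟨δ, hδ0, hδ⟩ := hδ (1 / (2 * (p * M ^ (p - 1)))) (by positivity)
  refine ⟨δ, hδ0, fun R hR hRR hvol => ?_⟩
  have hsub : halfSpace n ∩ ball 0 R ⊆ halfSpace n ∩ ball 0 R₀ :=
    inter_subset_inter_right _ (ball_subset_ball hRR)
  have hbs : badSet u R ⊆ halfSpace n ∩ ball 0 R := sep_subset _ _
  have key : ∀ k : ℕ, ∀ x ∈ halfSpace n ∩ ball 0 R, u x - u (inversion 0 R x) ≤ M / 2 ^ k := by
    intro k
    induction k with
    | zero =>
      intro x hx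
      have h1 := huM x (hsub hx)
      have h2 := h.pos _ (inversion_mem_halfSpace hR hx.1)
      simp only [pow_zero, div_one]
      linarith
    | succ k ih =>
      rw [pow_succ, ← div_div]
      exact h.sub_inversion_le_half hR hM (fun x hx => huM x (hsub hx))
        (fun x hx => (hint x (hsub hx)).mono_set hsub)
        (fun x hx => hδ x (hsub hx) _ (hbs.trans hsub) (h.isOpen_badSet R).measurableSet hvol)
        (by positivity) ih
  refine eq_empty_of_forall_notMem fun x hx => ?_
  have hlim : Tendsto (fun k : ℕ => M / 2 ^ k) atTop (𝓝 0) :=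
    tendsto_const_nhds.div_atTop (tendsto_pow_atTop_atTop_of_one_lt one_lt_two)
  have := ge_of_tendsto' hlim fun k => key k x hx.1
  linarith [hx.2]

theorem lt_inversion (h : IsPositiveSolution n a p C u) {R : ℝ} (hR : 0 < R)
    (hbad : badSet u R = ∅) {x : E n} (hx : x ∈ halfSpace n ∩ ball 0 R) :
    u x < u (inversion 0 R x) := by
  have hp : 0 < p := by linarith [h.one_le_exp]
  have ho : IsOpen (halfSpace n ∩ ball 0 R) := isOpen_halfSpace.inter isOpen_ball
  obtain ⟨i, e⟩ := h.sub_inversion_eq hR hx.1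
  have hneg : ∀ᵐ y ∂volume.restrict (halfSpace n ∩ ball 0 R),
      (green n C x y - green n C x (inversion 0 R y)) *
      (‖y‖ ^ a * u y ^ p -
        (R / ‖y‖) ^ (2 * n) * ‖inversion 0 R y‖ ^ a * u (inversion 0 R y) ^ p) < 0 := by
    filter_upwards [ae_ne h.one_le_dim x _, ae_restrict_mem ho.measurableSet] with y hxy hy
    have hk := green_inversion_right_lt h.const_pos hR hx.1 hy.1 hxy
      (mem_ball_zero_iff.1 hx.2) (mem_ball_zero_iff.1 hy.2)
    have h1 : u y ≤ u (inversion 0 R y) := by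
      by_contra hcon
      exact (eq_empty_iff_forall_notMem.1 hbad) y ⟨hy, not_le.1 hcon⟩
    have h2 : u y ^ p ≤ u (inversion 0 R y) ^ p := Real.rpow_le_rpow (h.pos y hy.1).le h1 hp.le
    refine mul_neg_of_pos_of_neg (by linarith) ((h.weight_sub_lt hy).trans_le ?_)
    exact mul_nonpos_of_nonneg_of_nonpos (by positivity) (by linarith)
  have hne : NeZero (volume.restrict (halfSpace n ∩ ball 0 R)) :=
    ⟨by simpa using (ho.measure_pos volume ⟨x, hx⟩).ne'⟩
  have hle := integral_nonpos_of_ae (hneg.mono fun y hy => hy.le)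
  rw [← e] at hle
  refine lt_of_le_of_ne (by linarith) fun heq => ?_
  have h0 := (integral_eq_zero_iff_of_nonneg_ae
    (hneg.mono fun y hy => by simpa using hy.le) i.neg).1
    (by simp only [Pi.neg_apply]; rw [integral_neg, ← e, heq, sub_self, neg_zero])
  obtain ⟨y, h1, h2⟩ := (hneg.and h0).exists
  simp only [Pi.zero_apply, Pi.neg_apply] at h2
  linarith

/-- The method of scaling spheres. -/
theorem badSet_eq_empty (h : IsPositiveSolution n a p C u) {R : ℝ} (hR : 0 < R) :
    badSet u R = ∅ := by
  by_contra hne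
  set S : Set ℝ := {r | 0 < r ∧ badSet u r ≠ ∅} with hS
  have hSne : S.Nonempty := ⟨R, hR, hne⟩
  have hSb : BddBelow S := ⟨0, fun r hr => hr.1.le⟩
  set r₀ := sInf S with hr₀
  have hr₀0 : 0 ≤ r₀ := le_csInf hSne fun r hr => hr.1.le
  have hlt : ∀ r, 0 < r → r < r₀ → badSet u r = ∅ := fun r hr hrr => by
    by_contra hcon
    exact absurd (csInf_le hSb ⟨hr, hcon⟩) (not_le.2 hrr)
  have hcont : ∀ {x : E n}, x ∈ halfSpace n → 0 < r₀ →
      ContinuousAt (fun r => u (inversion 0 r x)) r₀ := by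
    intro x hx hr
    refine ContinuousAt.comp (h.continuousAt (inversion_mem_halfSpace hr hx)) ?_
    simp only [inversion_zero_eq]
    fun_prop
  have hempty : 0 < r₀ → badSet u r₀ = ∅ := by
    intro hr
    refine eq_empty_of_forall_notMem fun x hx => ?_
    refine absurd hx.2 (not_lt.2 ?_)
    refine ge_of_tendsto ((hcont hx.1.1 hr).tendsto.mono_left nhdsWithin_le_nhds :
      Tendsto _ (𝓝[<] r₀) _) ?_
    have hxr := mem_ball_zero_iff.1 hx.1.2
    filter_upwards [Ioo_mem_nhdsLT hxr] with r hrr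
    by_contra hcon
    have : x ∈ badSet u r := ⟨⟨hx.1.1, mem_ball_zero_iff.2 hrr.1⟩, not_le.1 hcon⟩
    rw [hlt r ((norm_nonneg x).trans_lt hrr.1) hrr.2] at this
    exact this
  obtain ⟨δ, hδ0, hδ⟩ := h.exists_badSet_eq_empty (r₀ + 1)
  have hnt := nontrivial_E h.one_le_dim
  have htend : Tendsto (fun r => volume (badSet u r)) (𝓝[>] r₀) (𝓝 (volume (∅ : Set (E n)))) := by
    refine tendsto_measure_of_ae_tendsto_indicator _ MeasurableSet.empty
      (fun r => (h.isOpen_badSet r).measurableSet)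
      (measurableSet_ball (x := (0 : E n)) (ε := r₀ + 1))
      measure_ball_lt_top.ne ?_ ?_
    · filter_upwards [Ioo_mem_nhdsGT (lt_add_one r₀)] with r hr y hy
      exact ball_subset_ball hr.2.le hy.1.2
    · have hs : ∀ᵐ y : E n, y ∉ sphere (0 : E n) r₀ :=
        measure_eq_zero_iff_ae_notMem.1 (Measure.addHaar_sphere volume 0 r₀)
      filter_upwards [hs] with y hy
      simp only [mem_empty_iff_false, iff_false]
      by_cases hyH : y ∈ halfSpace n
      swap
      · exact Eventually.of_forall fun r hr => hyH hr.1.1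
      rw [mem_sphere_zero_iff_norm] at hy
      rcases lt_or_gt_of_ne hy with hlt' | hgt
      · have hr : 0 < r₀ := (norm_nonneg y).trans_lt hlt'
        have h1 := h.lt_inversion hr (hempty hr) ⟨hyH, mem_ball_zero_iff.2 hlt'⟩
        filter_upwards [((hcont hyH hr).eventually_const_lt h1).filter_mono nhdsWithin_le_nhds]
          with r h2 h3
        exact absurd h3.2 (not_lt.2 h2.le)
      · filter_upwards [Ioo_mem_nhdsGT hgt] with r hr h3
        exact absurd (mem_ball_zero_iff.1 h3.1.2) (not_lt.2 hr.2.le)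
  rw [measure_empty] at htend
  have hev : ∀ᶠ r in 𝓝[>] r₀, badSet u r = ∅ := by
    filter_upwards [htend.eventually_lt_const hδ0, Ioo_mem_nhdsGT (lt_add_one r₀)] with r h1 h2
    exact hδ r (hr₀0.trans_lt h2.1) h2.2.le h1
  obtain ⟨r₁, hr₁, hIoo⟩ := mem_nhdsGT_iff_exists_Ioo_subset.1 hev
  obtain ⟨r, hrS, hr⟩ := exists_lt_of_csInf_lt hSne hr₁
  rcases (csInf_le hSb hrS).eq_or_lt with heq | hlt'
  · exact hrS.2 (heq ▸ hempty (hr₀.trans heq ▸ hrS.1))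
  · exact hrS.2 (hIoo ⟨hlt', hr⟩)

end IsPositiveSolution

theorem green_ge_of_norm_le {n : ℕ} {C t : ℝ} (hC : 0 < C) {x y : E n} (hx0 : 0 < ‖x‖)
    (hx : ‖x‖ / 2 ≤ lastCoord n x) (hxt : ‖x‖ ≤ t) (hy3 : 3 * t ≤ ‖y‖) (hy5 : ‖y‖ ≤ 5 * t)
    (hy : 3 * t ≤ lastCoord n y) : C / 24 * (‖x‖ / t) ≤ green n C x y := by
  have ht : 0 < t := hx0.trans_le hxt
  have h1 : ‖x - y‖ ≤ 6 * t := (norm_sub_le x y).trans (by linarith)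
  have h2 : 0 < ‖x - y‖ := by
    have := norm_sub_norm_le y x
    rw [norm_sub_rev] at this
    linarith
  set s := ‖x‖ / (6 * t) with hs
  have hs0 : 0 < s := by positivity
  have hs1 : s ≤ 1 := by rw [hs, div_le_one (by positivity)]; linarith
  have h3 : s ≤ 4 * lastCoord n x * lastCoord n y / ‖x - y‖ ^ 2 := by
    calc s = 4 * (‖x‖ / 2) * (3 * t) / (6 * t) ^ 2 := by rw [hs]; field_simp; ring
      _ ≤ _ := by
        have hx' : 0 ≤ lastCoord n x := le_trans (by positivity) hx
        have hy' : 0 ≤ lastCoord n y := le_trans (by positivity) hy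
        have : 0 ≤ 4 * lastCoord n x * lastCoord n y := by positivity
        gcongr
  have h4 : s / 2 ≤ Real.log (1 + s) := by
    refine le_trans ?_ (Real.one_sub_inv_le_log_of_pos (by positivity))
    have : 1 - (1 + s)⁻¹ = s / (1 + s) := by field_simp; ring
    rw [this]
    gcongr
    linarith
  calc C / 24 * (‖x‖ / t) = C / 2 * (s / 2) := by rw [hs]; field_simp; ring
    _ ≤ C / 2 * Real.log (1 + s) := by gcongr
    _ ≤ green n C x y := by
        unfold green
        gcongr

theorem min_rpow_mul_le_rpow {a r t : ℝ} (ht : 0 < t) (h3 : 3 * t ≤ r) (h5 : r ≤ 5 * t) :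
    min (3 ^ a) (5 ^ a) * t ^ a ≤ r ^ a := by
  have hr : 0 < r := by linarith
  rcases le_total 0 a with ha | ha
  · calc min (3 ^ a) (5 ^ a) * t ^ a ≤ 3 ^ a * t ^ a := by gcongr; exact min_le_left _ _
      _ = (3 * t) ^ a := (Real.mul_rpow (by norm_num) ht.le).symm
      _ ≤ r ^ a := Real.rpow_le_rpow (by positivity) h3 ha
  · calc min (3 ^ a) (5 ^ a) * t ^ a ≤ 5 ^ a * t ^ a := by gcongr; exact min_le_right _ _
      _ = (5 * t) ^ a := (Real.mul_rpow (by norm_num) ht.le).symm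
      _ ≤ r ^ a := Real.rpow_le_rpow_of_nonpos hr h5 ha

namespace IsPositiveSolution

variable {n : ℕ} {a p C : ℝ} {u : E n → ℝ}

/-- Power growth in a cone propagates through the integral equation. -/
theorem le_of_growth (h : IsPositiveSolution n a p C u) {c k : ℝ} (hc : 0 < c) (hk : 0 ≤ k)
    (hgrow : ∀ z : E n, 1 ≤ ‖z‖ → ‖z‖ / 2 ≤ lastCoord n z → c * ‖z‖ ^ k ≤ u z)
    {x : E n} {t : ℝ} (hx1 : 1 ≤ ‖x‖) (hx : ‖x‖ / 2 ≤ lastCoord n x) (hxt : ‖x‖ ≤ t) :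
    C / 24 * min (3 ^ a) (5 ^ a) * volume.real (ball (0 : E n) 1) * c ^ p *
      (‖x‖ / t * t ^ (n + a + k)) ≤ u x := by
  have hC := h.const_pos
  have hnt := nontrivial_E h.one_le_dim
  have ht : 1 ≤ t := hx1.trans hxt
  have ht0 : 0 < t := by linarith
  have hxH : x ∈ halfSpace n := show 0 < lastCoord n x by linarith
  set B : Set (E n) := ball ((4 * t) • lastBasis n) t with hB
  have hyB : ∀ y ∈ B, 3 * t ≤ lastCoord n y ∧ ‖y‖ ≤ 5 * t := by
    intro y hy
    rw [hB, mem_ball, dist_eq_norm] at hy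
    have h1 := (abs_le.1 (abs_lastCoord_le (y - (4 * t) • lastBasis n))).1
    rw [lastCoord_sub, lastCoord_smul, lastCoord_lastBasis h.one_le_dim] at h1
    have h2 := norm_sub_norm_le y ((4 * t) • lastBasis n)
    rw [norm_smul, norm_lastBasis h.one_le_dim, Real.norm_of_nonneg (by positivity)] at h2
    constructor <;> linarith
  have hBH : B ⊆ halfSpace n := fun y hy => show 0 < lastCoord n y by linarith [(hyB y hy).1]
  have hF : ∀ y ∈ B, C / 24 * (‖x‖ / t) * (min (3 ^ a) (5 ^ a) * t ^ a * (c ^ p * t ^ k)) ≤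
      green n C x y * (‖y‖ ^ a * u y ^ p) := by
    intro y hy
    obtain ⟨h3, h5⟩ := hyB y hy
    have h3' : 3 * t ≤ ‖y‖ := h3.trans (lastCoord_le_norm y)
    have hg := green_ge_of_norm_le hC (by linarith) hx hxt h3' h5 h3
    have hw := min_rpow_mul_le_rpow (a := a) ht0 h3' h5
    have hu : c ^ p * t ^ k ≤ u y ^ p := by
      have hp := h.one_le_exp
      calc c ^ p * t ^ k ≤ c ^ p * (t ^ k) ^ p := by
            gcongr
            exact Real.self_le_rpow_of_one_le (Real.one_le_rpow ht hk) hp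
        _ = (c * t ^ k) ^ p := (Real.mul_rpow hc.le (by positivity)).symm
        _ ≤ (c * ‖y‖ ^ k) ^ p := by gcongr; linarith
        _ ≤ u y ^ p := by
            gcongr
            exact hgrow y (by linarith) (by linarith)
    have hg0 := green_nonneg hC hxH (hBH hy)
    gcongr
  have hnonneg : 0 ≤ᵐ[volume.restrict (halfSpace n)]
      fun y => green n C x y * (‖y‖ ^ a * u y ^ p) := by
    filter_upwards [ae_restrict_mem isOpen_halfSpace.measurableSet] with y hy
    have h1 := green_nonneg hC hxH hy
    have h2 := h.pos y hy
    positivity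
  have hvol : volume.real B = t ^ n * volume.real (ball (0 : E n) 1) := by
    rw [hB, measureReal_def, Measure.addHaar_ball _ _ ht0.le, ENNReal.toReal_mul,
      ENNReal.toReal_ofReal (by positivity), finrank_euclideanSpace_fin, measureReal_def]
  calc _ = C / 24 * (‖x‖ / t) * (min (3 ^ a) (5 ^ a) * t ^ a * (c ^ p * t ^ k)) *
        volume.real B := by
        rw [hvol, Real.rpow_add ht0, Real.rpow_add ht0, Real.rpow_natCast]
        ring
    _ ≤ ∫ y in B, green n C x y * (‖y‖ ^ a * u y ^ p) :=
        setIntegral_ge_of_const_le_real measurableSet_ball measure_ball_lt_top.ne hF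
          ((h.integrableOn x hxH).mono_set hBH)
    _ ≤ ∫ y in halfSpace n, green n C x y * (‖y‖ ^ a * u y ^ p) :=
        setIntegral_mono_set (h.integrableOn x hxH) hnonneg hBH.eventuallyLE
    _ = u x := (h.eq_integral x hxH).symm

theorem exists_lower_bound (h : IsPositiveSolution n a p C u) :
    ∃ c > 0, ∀ z : E n, 1 ≤ ‖z‖ → ‖z‖ / 2 ≤ lastCoord n z → c ≤ u z := by
  have hK : IsCompact (sphere (0 : E n) 1 ∩ {z | 1 / 2 ≤ lastCoord n z}) :=
    (isCompact_sphere 0 1).inter_right (isClosed_le continuous_const continuous_lastCoord)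
  have hKH : sphere (0 : E n) 1 ∩ {z | 1 / 2 ≤ lastCoord n z} ⊆ halfSpace n := fun z hz =>
    show 0 < lastCoord n z from lt_of_lt_of_le (by norm_num) hz.2
  obtain ⟨z₀, hz₀, hmin⟩ := hK.exists_isMinOn
    ⟨lastBasis n, by simp [norm_lastBasis h.one_le_dim], by
      simp only [mem_ofPred_eq, lastCoord_lastBasis h.one_le_dim]; norm_num⟩
    (h.continuousOn.mono (hKH.trans subset_closure))
  refine ⟨u z₀, h.pos _ (hKH hz₀), fun z hz1 hz => ?_⟩
  have hz0 : 0 < ‖z‖ := by linarith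
  set x := ‖z‖⁻¹ • z with hx
  have hx1 : ‖x‖ = 1 := by rw [hx, norm_smul, norm_inv, norm_norm, inv_mul_cancel₀ hz0.ne']
  have hxK : x ∈ sphere (0 : E n) 1 ∩ {z | 1 / 2 ≤ lastCoord n z} := by
    refine ⟨mem_sphere_zero_iff_norm.2 hx1, ?_⟩
    change 1 / 2 ≤ lastCoord n x
    rw [hx, lastCoord_smul, inv_mul_eq_div, le_div_iff₀ hz0]
    linarith
  refine (hmin hxK).trans ?_
  rcases hz1.eq_or_lt with h1 | h1
  · rw [hx, ← h1, inv_one, one_smul]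
  have hR : 0 < √‖z‖ := Real.sqrt_pos.2 hz0
  have hinv : inversion 0 (√‖z‖) x = z := by
    rw [inversion_zero_eq, hx1, div_one, Real.sq_sqrt hz0.le, hx, smul_inv_smul₀ hz0.ne']
  have hxR : ‖x‖ < √‖z‖ := by rw [hx1, Real.lt_sqrt zero_le_one]; linarith
  have := h.lt_inversion hR (h.badSet_eq_empty hR) ⟨hKH hxK, mem_ball_zero_iff.2 hxR⟩
  rw [hinv] at this
  exact this.le

theorem exists_growth (h : IsPositiveSolution n a p C u) (j : ℕ) :
    ∃ c > 0, ∀ z : E n, 1 ≤ ‖z‖ → ‖z‖ / 2 ≤ lastCoord n z → c * ‖z‖ ^ (j * (n + a)) ≤ u z := by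
  have hnt := nontrivial_E h.one_le_dim
  have hs : 0 < n + a := by linarith [h.neg_dim_lt]
  have hC := h.const_pos
  induction j with
  | zero => simpa using h.exists_lower_bound
  | succ j ih =>
    obtain ⟨c, hc, hgrow⟩ := ih
    have hv : 0 < volume.real (ball (0 : E n) 1) :=
      ENNReal.toReal_pos (measure_ball_pos _ _ one_pos).ne' measure_ball_lt_top.ne
    refine ⟨C / 24 * min (3 ^ a) (5 ^ a) * volume.real (ball (0 : E n) 1) * c ^ p, ?_,
      fun z hz1 hz => le_of_eq_of_le ?_
        (h.le_of_growth hc (by positivity) hgrow hz1 hz le_rfl)⟩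
    · have : 0 < min ((3 : ℝ) ^ a) (5 ^ a) := lt_min (by positivity) (by positivity)
      positivity
    · rw [div_self (by linarith), one_mul]
      push_cast
      ring_nf

theorem false (h : IsPositiveSolution n a p C u) : False := by
  have hnt := nontrivial_E h.one_le_dim
  have hs : 0 < n + a := by linarith [h.neg_dim_lt]
  have hC := h.const_pos
  obtain ⟨j, hj⟩ := exists_nat_ge (1 / (n + a))
  rw [div_le_iff₀ hs] at hj
  obtain ⟨c, hc, hgrow⟩ := h.exists_growth j
  have hv : 0 < volume.real (ball (0 : E n) 1) :=
    ENNReal.toReal_pos (measure_ball_pos _ _ one_pos).ne' measure_ball_lt_top.ne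
  have hmin : 0 < min ((3 : ℝ) ^ a) (5 ^ a) := lt_min (by positivity) (by positivity)
  set A := C / 24 * min (3 ^ a) (5 ^ a) * volume.real (ball (0 : E n) 1) * c ^ p with hA
  have hA0 : 0 < A := by positivity
  have he := norm_lastBasis h.one_le_dim
  have hlim : Tendsto (fun t : ℝ => A * t ^ (n + a)) atTop atTop :=
    (tendsto_rpow_atTop hs).const_mul_atTop hA0
  obtain ⟨t, ht1, ht⟩ :=
    ((eventually_ge_atTop 1).and (hlim.eventually_gt_atTop (u (lastBasis n)))).exists
  have ht0 : 0 < t := by linarith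
  have h1 := h.le_of_growth hc (by positivity) hgrow (x := lastBasis n) (t := t) he.ge
    (by rw [he, lastCoord_lastBasis h.one_le_dim]; norm_num) (by rwa [he])
  rw [← hA, he] at h1
  have h2 : t ^ (n + a) ≤ 1 / t * t ^ (n + a + j * (n + a)) := by
    rw [Real.rpow_add ht0 (n + a), one_div, inv_mul_eq_div, le_div_iff₀ ht0]
    gcongr
    exact Real.self_le_rpow_of_one_le ht1 hj
  have h3 := mul_le_mul_of_nonneg_left h2 hA0.le
  linarith

end IsPositiveSolution

/-- A nonnegative solution which does not vanish in the half space is positive there, with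
convergent integrals. -/
theorem isPositiveSolution_of_ne_zero {n : ℕ} (hn : 1 ≤ n) {a p C : ℝ} (ha : -(n : ℝ) < a)
    (hp : 1 ≤ p) (hC : 0 < C) {u : E n → ℝ} (hu : ContinuousOn u (closure (halfSpace n)))
    (hnonneg : ∀ x ∈ closure (halfSpace n), 0 ≤ u x)
    (hie : ∀ x ∈ halfSpace n,
      u x = ∫ y in halfSpace n, green n C x y * (‖y‖ ^ a * u y ^ p))
    {x₀ : E n} (hx₀ : x₀ ∈ halfSpace n) (hux₀ : u x₀ ≠ 0) : IsPositiveSolution n a p C u := by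
  have hm : MeasurableSet (halfSpace n) := isOpen_halfSpace.measurableSet
  have hi₀ : IntegrableOn (fun y => green n C x₀ y * (‖y‖ ^ a * u y ^ p)) (halfSpace n) := by
    by_contra hcon
    exact hux₀ ((hie x₀ hx₀).trans (integral_undef hcon))
  have hu0 : ∀ y ∈ halfSpace n, 0 ≤ u y := fun y hy => hnonneg y (subset_closure hy)
  have hmeas : ∀ x, AEStronglyMeasurable (fun y => green n C x y * (‖y‖ ^ a * u y ^ p))
      (volume.restrict (halfSpace n)) := by
    intro x
    have h1 := measurable_green (C := C) x
    have h2 : AEMeasurable u (volume.restrict (halfSpace n)) :=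
      (hu.mono subset_closure).aemeasurable hm
    exact AEMeasurable.aestronglyMeasurable (by fun_prop)
  have hi : ∀ x ∈ halfSpace n,
      IntegrableOn (fun y => green n C x y * (‖y‖ ^ a * u y ^ p)) (halfSpace n) := by
    intro x hx
    set R := 2 * ‖x‖ + ‖x₀‖ + 1 with hR
    obtain ⟨M, hM, huM⟩ := exists_forall_le_of_continuousOn_closure hu R
    have hxR : x ∈ halfSpace n ∩ ball 0 R :=
      ⟨hx, mem_ball_zero_iff.2 (by linarith [norm_nonneg x, norm_nonneg x₀])⟩
    rw [← inter_union_sdiff (halfSpace n) (ball 0 R)]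
    refine IntegrableOn.union ?_ ?_
    · refine Integrable.mono'
        (((exists_green_uniformly_integrable ha hn hC R).1 x hxR).const_mul (M ^ p))
        ((hmeas x).mono_measure (Measure.restrict_mono inter_subset_left le_rfl)) ?_
      filter_upwards [ae_restrict_mem (hm.inter measurableSet_ball)] with y hy
      have h1 := green_nonneg hC hx hy.1
      have h2 := hu0 y hy.1
      have h3 := huM y hy
      rw [Real.norm_of_nonneg (by positivity)]
      calc green n C x y * (‖y‖ ^ a * u y ^ p) ≤ green n C x y * (‖y‖ ^ a * M ^ p) := by gcongr
        _ = _ := by ring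
    · refine Integrable.mono' ((hi₀.mono_set sdiff_subset).const_mul
        (1 + 16 * lastCoord n x / lastCoord n x₀))
        ((hmeas x).mono_measure (Measure.restrict_mono sdiff_subset le_rfl)) ?_
      filter_upwards [ae_restrict_mem (hm.diff measurableSet_ball), ae_ne hn x₀ _] with y hy hne
      have h1 := green_nonneg hC hx hy.1
      have h2 := hu0 y hy.1
      have hyR : R ≤ ‖y‖ := by simpa using hy.2
      have h3 := green_le_mul_green hC hx hx₀ hy.1 (by linarith [norm_nonneg x₀])
        (by linarith [norm_nonneg x]) hne
      rw [Real.norm_of_nonneg (by positivity)]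
      exact (mul_le_mul_of_nonneg_right h3 (by positivity)).trans_eq (mul_assoc _ _ _)
  refine ⟨hn, ha, hp, hC, hu, fun x hx => (hu0 x hx).lt_of_ne' fun hux => hux₀ ?_, hi, hie⟩
  have hnn : 0 ≤ᵐ[volume.restrict (halfSpace n)]
      fun y => green n C x y * (‖y‖ ^ a * u y ^ p) := by
    filter_upwards [ae_restrict_mem hm] with y hy
    have h1 := green_nonneg hC hx hy
    have h2 := hu0 y hy
    positivity
  have h0 := (setIntegral_eq_zero_iff_of_nonneg_ae hnn (hi x hx)).1 ((hie x hx).symm.trans hux)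
  rw [hie x₀ hx₀]
  refine integral_eq_zero_of_ae ?_
  filter_upwards [h0, ae_ne hn x _, ae_restrict_mem hm] with y hy hxy hyH
  have := (mul_eq_zero.1 hy).resolve_left (green_pos hC hx hyH hxy).ne'
  simp [this]

/-- **Liouville theorem for the integral equation** (Theorem 1.4 of the paper).
For `n ≥ 1`, `1 ≤ p < ∞`, `−n < a < ∞` and a fixed constant `C_n > 0`, any nonnegative
continuous solution on `cl ℝⁿ₊` of
`u(x) = ∫_{ℝⁿ₊} C_n (ln(1/|x−y|) − ln(1/|x̄−y|)) |y|^a u(y)^p dy` is identically zero. -/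
theorem liouville_IE (n : ℕ) (hn : 1 ≤ n) (a p Cn : ℝ)
    (ha : -(n : ℝ) < a) (hp : 1 ≤ p) (hCn : 0 < Cn)
    (u : E n → ℝ)
    (hu : ContinuousOn u (closure (halfSpace n)))
    (hnonneg : ∀ x ∈ closure (halfSpace n), 0 ≤ u x)
    (hie : ∀ x ∈ halfSpace n,
      u x = ∫ y in halfSpace n, Gplus n Cn x y * ‖y‖ ^ a * u y ^ p) :
    ∀ x ∈ closure (halfSpace n), u x = 0 := by
  have hie' : ∀ x ∈ halfSpace n,
      u x = ∫ y in halfSpace n, green n Cn x y * (‖y‖ ^ a * u y ^ p) := by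
    intro x hx
    rw [hie x hx]
    refine integral_congr_ae ?_
    filter_upwards [ae_ne hn x _, ae_restrict_mem isOpen_halfSpace.measurableSet] with y hxy hy
    rw [Gplus_eq_green hn hx hy hxy, mul_assoc]
  have h0 : EqOn u 0 (halfSpace n) := by
    intro x hx
    by_contra hne
    exact (isPositiveSolution_of_ne_zero hn ha hp hCn hu hnonneg hie' hx hne).false
  exact h0.of_subset_closure hu continuousOn_const subset_closure le_rfl
end
end

section
/- Let n ≥ 1 and let C_n > 0. Then: (i) for all x, y ∈ ℝⁿ₊ with x ≠ y, one has the identity G⁺(x,y) = (C_n/2) ln(1 + 4xₙyₙ/|x−y|²), and consequently there is a constant C′ > 0 (depending only on C_n) such that G⁺(x,y) ≤ C′ · 4xₙyₙ/|x−y|² for all x ≠ y in ℝⁿ₊; (ii) there is a constant C″ > 0 (depending only on C_n) such that G⁺(x,y) ≥ C″ · 4xₙyₙ/|x−y|² for all x, y ∈ ℝⁿ₊ with |x|/|y| ≤ 1/100 or |y|/|x| ≤ 1/100. -/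
open MeasureTheory Real Set Metric

noncomputable section

theorem abs_lastCoord_le_norm (n : ℕ) (x : E n) : |lastCoord n x| ≤ ‖x‖ := by
  unfold lastCoord
  split_ifs with h
  · exact PiLp.norm_apply_le x _
  · simp

theorem norm_sq_reflect_sub {n : ℕ} (hn : 1 ≤ n) (x y : E n) :
    ‖reflect n x - y‖ ^ 2 = ‖x - y‖ ^ 2 + 4 * lastCoord n x * lastCoord n y := by
  have h : 0 < n := hn
  have hsub : reflect n x - y = (x - y) - (2 * lastCoord n x) • lastBasis n := by
    unfold reflect
    abel
  have hinner : inner ℝ (x - y) (lastBasis n) = lastCoord n x - lastCoord n y := by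
    simp [lastBasis, lastCoord, h, EuclideanSpace.inner_single_right]
  have hnorm : ‖lastBasis n‖ = 1 := by simp [lastBasis, h]
  rw [hsub, norm_sub_sq_real, inner_smul_right, hinner, norm_smul, hnorm, mul_one,
    Real.norm_eq_abs, sq_abs]
  ring

theorem Gplus_eq_log {n : ℕ} (hn : 1 ≤ n) (Cn : ℝ) {x y : E n} (hx : x ∈ halfSpace n)
    (hy : y ∈ halfSpace n) (hxy : x ≠ y) :
    Gplus n Cn x y =
      Cn / 2 * Real.log (1 + 4 * lastCoord n x * lastCoord n y / ‖x - y‖ ^ 2) := by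
  have hd : 0 < ‖x - y‖ := norm_sub_pos_iff.mpr hxy
  have hp : 0 < 4 * lastCoord n x * lastCoord n y := mul_pos (mul_pos four_pos hx) hy
  have hr := norm_sq_reflect_sub hn x y
  have hr0 : ‖reflect n x - y‖ ^ 2 ≠ 0 := by
    rw [hr]
    positivity
  have harg : 1 + 4 * lastCoord n x * lastCoord n y / ‖x - y‖ ^ 2 =
      ‖reflect n x - y‖ ^ 2 / ‖x - y‖ ^ 2 := by
    rw [hr]
    field_simp
  rw [harg, Real.log_div hr0 (by positivity), Real.log_pow, Real.log_pow, Gplus, one_div,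
    one_div, Real.log_inv, Real.log_inv]
  push_cast
  ring

theorem four_mul_mul_le_norm_sub_sq {V : Type*} [SeminormedAddCommGroup V] {x y : V}
    (h : ‖x‖ ≤ 1 / 100 * ‖y‖) : 4 * (‖x‖ * ‖y‖) ≤ ‖x - y‖ ^ 2 := by
  have h1 : ‖y‖ - ‖x‖ ≤ ‖x - y‖ := by
    rw [norm_sub_rev]
    exact norm_sub_norm_le y x
  nlinarith [norm_nonneg x, norm_nonneg y, norm_nonneg (x - y)]

theorem ratio_le_one_of_norm_div_le {n : ℕ} {x y : E n} (hx : x ∈ halfSpace n)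
    (hy : y ∈ halfSpace n) (h : ‖x‖ / ‖y‖ ≤ 1 / 100 ∨ ‖y‖ / ‖x‖ ≤ 1 / 100) :
    4 * lastCoord n x * lastCoord n y / ‖x - y‖ ^ 2 ≤ 1 := by
  have hx0 : 0 < lastCoord n x := hx
  have hy0 : 0 < lastCoord n y := hy
  have hxn : lastCoord n x ≤ ‖x‖ := (le_abs_self _).trans (abs_lastCoord_le_norm n x)
  have hyn : lastCoord n y ≤ ‖y‖ := (le_abs_self _).trans (abs_lastCoord_le_norm n y)
  have hnorm : 4 * (‖x‖ * ‖y‖) ≤ ‖x - y‖ ^ 2 := by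
    rcases h with h | h
    · exact four_mul_mul_le_norm_sub_sq ((div_le_iff₀ (hy0.trans_le hyn)).mp h)
    · rw [mul_comm ‖x‖, norm_sub_rev]
      exact four_mul_mul_le_norm_sub_sq ((div_le_iff₀ (hx0.trans_le hxn)).mp h)
  refine div_le_one_of_le₀ ?_ (sq_nonneg _)
  have := mul_le_mul hxn hyn hy0.le (norm_nonneg x)
  linarith

theorem half_le_log_one_add {t : ℝ} (h0 : 0 ≤ t) (h1 : t ≤ 1) :
    t / 2 ≤ Real.log (1 + t) := by
  refine le_trans ?_ (Real.one_sub_inv_le_log_of_pos (by linarith))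
  have : 1 - (1 + t)⁻¹ = t / (1 + t) := by
    field_simp
    ring
  rw [this]
  gcongr
  linarith

/-- **Pointwise identity and two-sided bounds for the Green function `G⁺`** (formula (4.10)
and Lemma 4.1, (4.15)–(4.16) of the paper). For `n ≥ 1` and `C_n > 0`:
(i) `G⁺(x,y) = (C_n/2) ln(1 + 4xₙyₙ/|x−y|²)` for `x ≠ y` in `ℝⁿ₊`, and hence
`G⁺(x,y) ≤ C′ · 4xₙyₙ/|x−y|²` for some `C′ > 0`;
(ii) `G⁺(x,y) ≥ C″ · 4xₙyₙ/|x−y|²` for some `C″ > 0`, whenever `|x|/|y| ≤ 1/100` or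
`|y|/|x| ≤ 1/100`. -/
theorem Gplus_bounds (n : ℕ) (hn : 1 ≤ n) (Cn : ℝ) (hCn : 0 < Cn) :
    (∀ x ∈ halfSpace n, ∀ y ∈ halfSpace n, x ≠ y →
      Gplus n Cn x y =
        Cn / 2 * Real.log (1 + 4 * lastCoord n x * lastCoord n y / ‖x - y‖ ^ 2)) ∧
    (∃ C' > 0, ∀ x ∈ halfSpace n, ∀ y ∈ halfSpace n, x ≠ y →
      Gplus n Cn x y ≤ C' * (4 * lastCoord n x * lastCoord n y / ‖x - y‖ ^ 2)) ∧
    (∃ C'' > 0, ∀ x ∈ halfSpace n, ∀ y ∈ halfSpace n,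
      (‖x‖ / ‖y‖ ≤ 1 / 100 ∨ ‖y‖ / ‖x‖ ≤ 1 / 100) →
      C'' * (4 * lastCoord n x * lastCoord n y / ‖x - y‖ ^ 2) ≤ Gplus n Cn x y) := by
  refine ⟨fun x hx y hy hxy => Gplus_eq_log hn Cn hx hy hxy,
    ⟨Cn / 2, half_pos hCn, fun x hx y hy hxy => ?_⟩,
    ⟨Cn / 4, by positivity, fun x hx y hy h => ?_⟩⟩
  · have hp : 0 < 4 * lastCoord n x * lastCoord n y := mul_pos (mul_pos four_pos hx) hy
    rw [Gplus_eq_log hn Cn hx hy hxy]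
    gcongr
    have := Real.log_le_sub_one_of_pos
      (show 0 < 1 + 4 * lastCoord n x * lastCoord n y / ‖x - y‖ ^ 2 by positivity)
    linarith
  · have hp : 0 < 4 * lastCoord n x * lastCoord n y := mul_pos (mul_pos four_pos hx) hy
    have hxy : x ≠ y := by
      rintro rfl
      have hx0 : 0 < ‖x‖ :=
        lt_of_lt_of_le hx ((le_abs_self _).trans (abs_lastCoord_le_norm n x))
      rw [div_self hx0.ne'] at h
      norm_num at h
    rw [Gplus_eq_log hn Cn hx hy hxy]
    have := mul_le_mul_of_nonneg_left
      (half_le_log_one_add (by positivity) (ratio_le_one_of_norm_div_le hx hy h))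
      (half_pos hCn).le
    linarith
end
end

section
/- Let n ≥ 1 and let C_n > 0. For every ε > 0 there exist constants δ(ε) > 0 and C > 0 (depending only on ε and C_n) such that for every λ > 0 and all x, y ∈ B_λ(0) ∩ ℝⁿ₊ with x ≠ y: (i) if |x−y| < λ δ(ε), then G⁺(x,y) ≤ C λ^{2ε} / |x−y|^{2ε}; (ii) if |x−y| ≥ λ δ(ε), then G⁺(x,y) ≤ C ln(1 + 4/δ(ε)²). -/
open MeasureTheory Real Set Metric

noncomputable section

theorem lastCoord_eq {n : ℕ} (hn : 0 < n) (x : E n) :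
    lastCoord n x = x ⟨n - 1, Nat.sub_lt hn Nat.one_pos⟩ := by
  simp [lastCoord, hn]

theorem lastBasis_eq {n : ℕ} (hn : 0 < n) :
    lastBasis n = EuclideanSpace.single ⟨n - 1, Nat.sub_lt hn Nat.one_pos⟩ (1 : ℝ) := by
  simp [lastBasis, hn]

theorem lastCoord_reflect {n : ℕ} (hn : 0 < n) (x : E n) :
    lastCoord n (reflect n x) = -lastCoord n x := by
  rw [lastCoord_eq hn (reflect n x), reflect, lastBasis_eq hn]
  simp only [PiLp.sub_apply, PiLp.smul_apply, PiLp.single_apply, if_true, smul_eq_mul,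
    lastCoord_eq hn x]
  ring

theorem norm_reflect {n : ℕ} (hn : 0 < n) (x : E n) : ‖reflect n x‖ = ‖x‖ := by
  rw [← sq_eq_sq₀ (norm_nonneg _) (norm_nonneg _), reflect, norm_sub_sq_real, lastBasis_eq hn,
    norm_smul, inner_smul_right, EuclideanSpace.inner_single_right, PiLp.norm_single,
    lastCoord_eq hn x, mul_pow, norm_one, Real.norm_eq_abs, sq_abs]
  simp only [conj_trivial]
  ring

theorem reflect_ne {n : ℕ} (hn : 0 < n) {x y : E n} (hx : x ∈ halfSpace n)
    (hy : y ∈ halfSpace n) : reflect n x ≠ y := by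
  rintro rfl
  have hx' : 0 < lastCoord n x := hx
  have hy' : 0 < lastCoord n (reflect n x) := hy
  rw [lastCoord_reflect hn] at hy'
  linarith

theorem Gplus_le_log {n : ℕ} (hn : 0 < n) {Cn lam : ℝ} (hCn : 0 < Cn) {x y : E n}
    (hx : x ∈ ball (0 : E n) lam ∩ halfSpace n) (hy : y ∈ ball (0 : E n) lam ∩ halfSpace n)
    (hxy : x ≠ y) : Gplus n Cn x y ≤ Cn * Real.log (2 * lam / ‖x - y‖) := by
  have hr : 0 < ‖x - y‖ := norm_pos_iff.2 (sub_ne_zero.2 hxy)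
  have hs : 0 < ‖reflect n x - y‖ := norm_pos_iff.2 (sub_ne_zero.2 (reflect_ne hn hx.2 hy.2))
  have hx' : ‖x‖ < lam := mem_ball_zero_iff.1 hx.1
  have hy' : ‖y‖ < lam := mem_ball_zero_iff.1 hy.1
  have hle : ‖reflect n x - y‖ ≤ 2 * lam := by
    have := norm_sub_le (reflect n x) y
    rw [norm_reflect hn] at this
    linarith
  rw [Gplus, one_div, one_div, Real.log_inv, Real.log_inv, Real.log_div (by linarith) hr.ne']
  have := Real.log_le_log hs hle
  exact mul_le_mul_of_nonneg_left (by linarith) hCn.le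

/-- **Upper bounds for the Green function `G⁺` in a ball** (Lemma 4.1, (4.13)–(4.14) of the
paper). For every `ε > 0` there are constants `δ(ε) > 0` and `C > 0` (depending only on `ε`
and `C_n`) such that for every `λ > 0` and all distinct `x, y ∈ B_λ(0) ∩ ℝⁿ₊`:
(i) `G⁺(x,y) ≤ C λ^{2ε}/|x−y|^{2ε}` when `|x−y| < λδ(ε)`;
(ii) `G⁺(x,y) ≤ C ln(1 + 4/δ(ε)²)` when `|x−y| ≥ λδ(ε)`. -/
theorem Gplus_ball_bounds (n : ℕ) (hn : 1 ≤ n) (Cn : ℝ) (hCn : 0 < Cn) :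
    ∀ ε : ℝ, 0 < ε → ∃ δ > 0, ∃ C > 0, ∀ lam : ℝ, 0 < lam →
      ∀ x ∈ Metric.ball (0 : E n) lam ∩ halfSpace n,
      ∀ y ∈ Metric.ball (0 : E n) lam ∩ halfSpace n, x ≠ y →
        (‖x - y‖ < lam * δ →
          Gplus n Cn x y ≤ C * lam ^ (2 * ε) / ‖x - y‖ ^ (2 * ε)) ∧
        (lam * δ ≤ ‖x - y‖ →
          Gplus n Cn x y ≤ C * Real.log (1 + 4 / δ ^ 2)) := by
  intro ε hε
  have hK : 0 < (2 : ℝ) ^ (2 * ε) / (2 * ε) := by positivity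
  refine ⟨1, one_pos, Cn * (1 + 2 ^ (2 * ε) / (2 * ε)), by positivity, ?_⟩
  intro lam hlam x hx y hy hxy
  have hr : 0 < ‖x - y‖ := norm_pos_iff.2 (sub_ne_zero.2 hxy)
  have hG := Gplus_le_log hn hCn hx hy hxy
  refine ⟨fun _ => ?_, fun h => ?_⟩
  · calc
      Gplus n Cn x y ≤ Cn * Real.log (2 * lam / ‖x - y‖) := hG
      _ ≤ Cn * ((2 * lam / ‖x - y‖) ^ (2 * ε) / (2 * ε)) := by
        gcongr
        exact Real.log_le_rpow_div (by positivity) (by positivity)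
      _ = Cn * (2 ^ (2 * ε) / (2 * ε)) * lam ^ (2 * ε) / ‖x - y‖ ^ (2 * ε) := by
        rw [Real.div_rpow (by positivity) hr.le, Real.mul_rpow (by positivity) hlam.le]
        ring
      _ ≤ Cn * (1 + 2 ^ (2 * ε) / (2 * ε)) * lam ^ (2 * ε) / ‖x - y‖ ^ (2 * ε) := by
        gcongr
        linarith
  · have hratio : 2 * lam / ‖x - y‖ ≤ 1 + 4 / 1 ^ 2 := by
      rw [div_le_iff₀ hr]
      linarith
    have hlog : 0 ≤ Real.log (1 + 4 / 1 ^ 2) := Real.log_nonneg (by norm_num)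
    calc
      Gplus n Cn x y ≤ Cn * Real.log (2 * lam / ‖x - y‖) := hG
      _ ≤ Cn * Real.log (1 + 4 / 1 ^ 2) := by gcongr
      _ ≤ Cn * (1 + 2 ^ (2 * ε) / (2 * ε)) * Real.log (1 + 4 / 1 ^ 2) := by
        gcongr
        exact le_mul_of_one_le_right hCn.le (by linarith)
end
end
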